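/- arXiv:1610.05865 — 2 statements merged into one kernel-verified Lean document; each statement's English description precedes it below -/
import Mathlib

section
/- Let f : ℍ → ℂ be defined by f(τ) = η(3τ)³/η(τ)³. Then f is holomorphic on ℍ and satisfies the second-order modular linear differential equation D²f − (1/6)·E₂·Df − (1/48)·E₄·f = 0 on ℍ (this is the MLDE of weight 0 with parameter h = 2, since (h−1)(h+1)/144 = 3/144 = 1/48). (In the paper, f is the normalized character of the simple affine vertex algebra V_{−4/3}(A₁).) -/
noncomputable section

open Complex

/-- `q = exp(2πiτ)`. -/
def qc (τ : ℂ) : ℂ := Complex.exp (2 * (Real.pi : ℂ) * Complex.I * τ)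

/-- `σ_k(n) = ∑_{d ∣ n} d^k`, as a complex number. -/
def sigmaC (k n : ℕ) : ℂ := ∑ d ∈ n.divisors, (d : ℂ) ^ k

/-- Eisenstein series `E₂(τ) = 1 - 24 ∑_{n≥1} σ₁(n) qⁿ`. -/
def E2 (τ : ℂ) : ℂ := 1 - 24 * ∑' n : ℕ, sigmaC 1 (n + 1) * qc τ ^ (n + 1)

/-- Eisenstein series `E₄(τ) = 1 + 240 ∑_{n≥1} σ₃(n) qⁿ`. -/
def E4 (τ : ℂ) : ℂ := 1 + 240 * ∑' n : ℕ, sigmaC 3 (n + 1) * qc τ ^ (n + 1)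

/-- Eisenstein series `E₆(τ) = 1 - 504 ∑_{n≥1} σ₅(n) qⁿ`. -/
def E6 (τ : ℂ) : ℂ := 1 - 504 * ∑' n : ℕ, sigmaC 5 (n + 1) * qc τ ^ (n + 1)

/-- The normalized derivative of `E₄`: `(DE₄)(τ) = 240 ∑_{n≥1} n σ₃(n) qⁿ`. -/
def DE4 (τ : ℂ) : ℂ := 240 * ∑' n : ℕ, ((n : ℂ) + 1) * sigmaC 3 (n + 1) * qc τ ^ (n + 1)

/-- Dedekind eta function `η(τ) = exp(2πiτ/24) ∏_{n≥1} (1 - qⁿ)`. -/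
def dedekindEta (τ : ℂ) : ℂ :=
  Complex.exp (2 * (Real.pi : ℂ) * Complex.I * τ / 24) * ∏' n : ℕ, (1 - qc τ ^ (n + 1))

/-- Normalized derivative `D = (2πi)⁻¹ d/dτ`. -/
def Dop (f : ℂ → ℂ) : ℂ → ℂ := fun τ => (2 * (Real.pi : ℂ) * Complex.I)⁻¹ * deriv f τ

/-- The upper half-plane, as a subset of `ℂ`. -/
def UHP : Set ℂ := {τ : ℂ | 0 < τ.im}

/-- The normalized character of `V_{-4/3}(A₁)`: `f(τ) = η(3τ)³ / η(τ)³`. -/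
def charA1 (τ : ℂ) : ℂ := dedekindEta (3 * τ) ^ 3 / dedekindEta τ ^ 3


open UpperHalfPlane ModularForm MatrixGroups in
lemma slash_T_apply' (f : ℍ → ℂ) (k : ℤ) (z : ℍ) :
    (f ∣[k] ModularGroup.T) z = f ((1 : ℝ) +ᵥ z) := by
  have h : denom ModularGroup.T z = 1 := by
    rw [ModularGroup.denom_apply]
    have h1 : ModularGroup.T 1 0 = 0 := rfl
    have h2 : ModularGroup.T 1 1 = 1 := rfl
    rw [h1, h2]; simp
  rw [ModularForm.SL_slash_apply, UpperHalfPlane.modular_T_smul, h]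
  simp

open UpperHalfPlane ModularForm MatrixGroups in
/-- Level one vanishing principle. -/
lemma levelOne_vanish (G : ℂ → ℂ) (k m : ℕ) (hkm : k < 12 * m)
    (hd : DifferentiableOn ℂ G UHP)
    (hT : ∀ τ ∈ UHP, G (τ + 1) = G τ)
    (hS : ∀ τ ∈ UHP, G (-1 / τ) = τ ^ k * G τ)
    (hO : (fun τ : ℍ => G τ) =O[atImInfty] fun τ : ℍ => qc τ ^ m) :
    ∀ τ ∈ UHP, G τ = 0 := by
  have hη : ∀ z : ℍ, ModularForm.discriminant z ≠ 0 := ModularForm.discriminant_ne_zero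
  have hDT : ∀ z : ℍ, ModularForm.discriminant ((1 : ℝ) +ᵥ z) = ModularForm.discriminant z := by
    intro z
    have := congrFun ModularForm.discriminant_T_invariant z
    rwa [slash_T_apply'] at this
  have hDS : ∀ z : ℍ, ModularForm.discriminant (.mk _ z.im_inv_neg_coe_pos)
      = (z : ℂ) ^ 12 * ModularForm.discriminant z := by
    intro z
    have := congrFun ModularForm.discriminant_S_invariant z
    rw [SlashInvariantForm.slash_S_apply, zpow_neg, ← div_eq_mul_inv,
      div_eq_iff (zpow_ne_zero _ z.ne_zero)] at this
    rw [this, mul_comm]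
    rfl
  let H : ℍ → ℂ := fun z => G z / ModularForm.discriminant z ^ m
  have hHT : H ∣[((k : ℤ) - 12 * m)] ModularGroup.T = H := by
    ext z
    rw [slash_T_apply']
    have h1 : G ((1 : ℂ) + z) = G z := by rw [add_comm]; exact hT z z.2
    simp [H, hDT, h1]
  have hHS : H ∣[((k : ℤ) - 12 * m)] ModularGroup.S = H := by
    ext z
    rw [SlashInvariantForm.slash_S_apply]
    have hz := z.ne_zero
    have h1 : G (-(z : ℂ))⁻¹ = z ^ k * G z := by
      rw [← hS z z.2]
      congr 1
      rw [neg_div, one_div, inv_neg]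
    have h2 := hDS z
    have h3 : H (.mk _ z.im_inv_neg_coe_pos) = G (-(z : ℂ))⁻¹ /
      ModularForm.discriminant (.mk _ z.im_inv_neg_coe_pos) ^ m := rfl
    rw [h3, h1, h2, neg_sub, zpow_sub₀ hz]
    have h4 : H z = G z / ModularForm.discriminant z ^ m := rfl
    have h5 : (z : ℂ) ^ (12 * (m : ℤ)) = ((z : ℂ) ^ 12) ^ m := by
      rw [← pow_mul]; norm_cast
    have h6 : (z : ℂ) ^ (k : ℤ) = (z : ℂ) ^ k := zpow_natCast _ _
    rw [h4, h5, h6, mul_pow]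
    generalize ModularForm.discriminant z ^ m = d
    have h7 : (z : ℂ) ^ k ≠ 0 := pow_ne_zero _ hz
    have h8 : ((z : ℂ) ^ 12) ^ m ≠ 0 := pow_ne_zero _ (pow_ne_zero _ hz)
    generalize (z : ℂ) ^ k = x at *
    generalize ((z : ℂ) ^ 12) ^ m = y at *
    rw [mul_div_mul_comm]
    field_simp
  have hinv := SlashInvariantForm.slash_action_generators_SL2Z hHS hHT
  have hb : IsBoundedAtImInfty H := by
    have h1 : (fun τ : ℍ => qc τ ^ m) =O[atImInfty]
        fun τ : ℍ => ModularForm.discriminant τ ^ m := by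
      apply Asymptotics.IsBigO.pow
      refine Asymptotics.IsBigO.trans ?_ ModularForm.exp_isBigO_discriminant
      refine Asymptotics.IsBigO.of_bound 1 (Filter.Eventually.of_forall fun τ => ?_)
      simp [qc, Complex.norm_exp]
    have h2 := hO.trans h1
    have h3 := h2.mul (Asymptotics.isBigO_refl (fun τ : ℍ => (ModularForm.discriminant τ ^ m)⁻¹)
      atImInfty)
    refine (h3.congr_left (fun τ => ?_)).trans ?_
    · rfl
    · refine Asymptotics.IsBigO.of_bound 1 (Filter.Eventually.of_forall fun τ => ?_)
      simp [hη τ]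
  let M : ModularForm (Matrix.SpecialLinearGroup.mapGL ℝ : Matrix.SpecialLinearGroup (Fin 2) ℤ →* _).range ((k : ℤ) - 12 * m) :=
    { toFun := H
      slash_action_eq' := by
        rintro A ⟨A, rfl⟩
        exact hinv A
      holo' := by
        rw [UpperHalfPlane.mdifferentiable_iff]
        have h1 : DifferentiableOn ℂ (fun z => G z / (ModularForm.eta z ^ 24) ^ m) UHP := by
          refine hd.div ?_ ?_
          · intro z hz
            exact (((ModularForm.differentiableAt_eta_of_mem_upperHalfPlaneSet hz).pow 24).pow
              m).differentiableWithinAt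
          · intro z hz
            exact pow_ne_zero _ (pow_ne_zero _ (ModularForm.eta_ne_zero hz))
        refine h1.congr fun z hz => ?_
        simp [H, ModularForm.discriminant, ofComplex_apply_of_im_pos hz]
      bdd_at_cusps' := by
        intro c hc
        rw [Subgroup.IsArithmetic.isCusp_iff_isCusp_SL2Z] at hc
        rw [OnePoint.isBoundedAt_iff_forall_SL2Z hc]
        intro γ _
        rw [hinv]
        exact hb }
  have hM := ModularFormClass.levelOne_neg_weight_eq_zero (k := (k : ℤ) - 12 * m) (by omega) M
  intro τ hτ
  have : H ⟨τ, hτ⟩ = 0 := congrFun hM ⟨τ, hτ⟩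
  simp only [H, div_eq_zero_iff] at this
  rcases this with h | h
  · exact h
  · exact absurd h (pow_ne_zero _ (hη _))

lemma sigmaC_eq (k n : ℕ) : sigmaC k n = (ArithmeticFunction.sigma k n : ℂ) := by
  simp [sigmaC, ArithmeticFunction.sigma_apply]

/-- The shifted power series. -/
def gser (k : ℕ) (x : ℂ) : ℂ := ∑' n : ℕ, sigmaC k (n + 1) * x ^ n

lemma gser_differentiableOn (k : ℕ) : DifferentiableOn ℂ (gser k) (Metric.ball 0 1) := by
  intro x hx
  rw [mem_ball_zero_iff] at hx
  obtain ⟨r, hr1, hr2⟩ := exists_between hx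
  have hr0 : 0 < r := lt_of_le_of_lt (norm_nonneg _) hr1
  have hsum : Summable fun n : ℕ => ((n : ℝ) + 1) ^ (k + 1) * r ^ n := by
    have h1 := summable_norm_pow_mul_geometric_of_norm_lt_one (R := ℝ) (k + 1) (r := r)
      (by rw [Real.norm_of_nonneg hr0.le]; exact hr2)
    have h2 := ((summable_nat_add_iff 1).mpr h1).mul_left r⁻¹
    refine h2.congr fun n => ?_
    rw [Real.norm_of_nonneg (by positivity)]
    push_cast
    rw [pow_succ r n]
    field_simp
  have hd : DifferentiableOn ℂ (gser k) (Metric.ball 0 r) := by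
    refine Complex.differentiableOn_tsum_of_summable_norm hsum (fun i => by fun_prop)
      Metric.isOpen_ball ?_
    intro i w hw
    rw [mem_ball_zero_iff] at hw
    rw [norm_mul, norm_pow]
    gcongr
    rw [sigmaC_eq, Complex.norm_natCast]
    exact_mod_cast ArithmeticFunction.sigma_le_pow_succ k (i + 1)
  exact (hd.differentiableAt (Metric.isOpen_ball.mem_nhds
    (mem_ball_zero_iff.mpr hr1))).differentiableWithinAt

lemma gser_zero (k : ℕ) : gser k 0 = 1 := by
  rw [gser, tsum_eq_single 0]
  · simp [sigmaC]
  · intro n hn; simp [hn]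

lemma ser_eq (k : ℕ) (x : ℂ) : ∑' n : ℕ, sigmaC k (n + 1) * x ^ (n + 1) = x * gser k x := by
  rw [gser, ← tsum_mul_left]
  exact tsum_congr fun n => by ring

lemma gser_bigO (k : ℕ) : (fun x => x * gser k x - x) =O[nhds 0] fun x : ℂ => x ^ 2 := by
  have h := ((gser_differentiableOn k).differentiableAt
    (Metric.isOpen_ball.mem_nhds (Metric.mem_ball_self one_pos))).isBigO_sub
  have h2 := (Asymptotics.isBigO_refl (fun x : ℂ => x) (nhds 0)).mul h
  refine h2.congr (fun x => ?_) (fun x => ?_)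
  · rw [gser_zero]; ring
  · ring

def pf (x : ℂ) : ℂ := 1 - 24 * (x * gser 1 x)
def qf (x : ℂ) : ℂ := 1 + 240 * (x * gser 3 x)

lemma E2_eq_pf (τ : ℂ) : E2 τ = pf (qc τ) := by rw [E2, ser_eq, pf]
lemma E4_eq_qf (τ : ℂ) : E4 τ = qf (qc τ) := by rw [E4, ser_eq, qf]

lemma pf_diff : DifferentiableOn ℂ pf (Metric.ball 0 1) := by
  have := gser_differentiableOn 1
  unfold pf; fun_prop
lemma qf_diff : DifferentiableOn ℂ qf (Metric.ball 0 1) := by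
  have := gser_differentiableOn 3
  unfold qf; fun_prop

lemma pf_bigO : (fun x => pf x - (1 - 24 * x)) =O[nhds 0] fun x : ℂ => x ^ 2 := by
  refine ((gser_bigO 1).const_mul_left (-24)).congr_left fun x => ?_
  rw [pf]; ring
lemma qf_bigO : (fun x => qf x - (1 + 240 * x)) =O[nhds 0] fun x : ℂ => x ^ 2 := by
  refine ((gser_bigO 3).const_mul_left 240).congr_left fun x => ?_
  rw [qf]; ring

lemma qc_norm {τ : ℂ} (h : τ ∈ UHP) : qc τ ∈ Metric.ball (0 : ℂ) 1 := by
  rw [mem_ball_zero_iff]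
  exact UpperHalfPlane.norm_exp_two_pi_I_lt_one ⟨τ, h⟩

lemma qc_diff : Differentiable ℂ qc := by unfold qc; fun_prop

lemma isOpen_UHP : IsOpen UHP := isOpen_lt continuous_const Complex.continuous_im

lemma E2_diff : DifferentiableOn ℂ E2 UHP := by
  have : E2 = pf ∘ qc := funext E2_eq_pf
  rw [this]
  exact pf_diff.comp qc_diff.differentiableOn fun τ h => qc_norm h
lemma E4_diff : DifferentiableOn ℂ E4 UHP := by
  have : E4 = qf ∘ qc := funext E4_eq_qf
  rw [this]
  exact qf_diff.comp qc_diff.differentiableOn fun τ h => qc_norm h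

lemma qc_add_one (τ : ℂ) : qc (τ + 1) = qc τ := by
  rw [qc, qc, mul_add, mul_one, Complex.exp_add, Complex.exp_two_pi_mul_I, mul_one]
lemma E2_add_one (τ : ℂ) : E2 (τ + 1) = E2 τ := by rw [E2_eq_pf, E2_eq_pf, qc_add_one]
lemma E4_add_one (τ : ℂ) : E4 (τ + 1) = E4 τ := by rw [E4_eq_qf, E4_eq_qf, qc_add_one]

lemma E2_eq_mathlib (z : UpperHalfPlane) : E2 z = EisensteinSeries.E2 z := by
  rw [EisensteinSeries.E2_eq_tsum_cexp, E2]
  congr 2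
  rw [tsum_pnat_eq_tsum_succ (f := fun n => (ArithmeticFunction.sigma 1 n : ℂ) * _ ^ n)]
  refine tsum_congr fun n => ?_
  rw [sigmaC_eq]
  simp [qc]

lemma E4_eq_mathlib (z : UpperHalfPlane) : E4 z = ModularForm.E (k := 4) (by norm_num) z := by
  rw [EisensteinSeries.q_expansion_bernoulli (by norm_num) (by decide), E4,
    show bernoulli 4 = -1 / 30 by decide +kernel]
  have : (1 : ℂ) - 2 * ((4 : ℕ) : ℂ) / ((-1 / 30 : ℚ) : ℂ) * (∑' n : ℕ+,
      (ArithmeticFunction.sigma (4 - 1) n : ℂ) * Complex.exp (2 * Real.pi * I * z) ^ (n : ℤ))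
      = 1 + 240 * ∑' n : ℕ+,
      (ArithmeticFunction.sigma 3 n : ℂ) * Complex.exp (2 * Real.pi * I * z) ^ (n : ℕ) := by
    push_cast
    norm_num
  refine Eq.trans ?_ this.symm
  rw [tsum_pnat_eq_tsum_succ (f := fun n => (ArithmeticFunction.sigma 3 n : ℂ) * _ ^ n)]
  congr 2
  refine tsum_congr fun n => ?_
  rw [sigmaC_eq]
  simp [qc]

/-- anomaly constant -/
def cc : ℂ := 6 / (Real.pi * I)

lemma E2_S {τ : ℂ} (h : τ ∈ UHP) : E2 (-1 / τ) = τ ^ 2 * E2 τ + cc * τ := by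
  let z : UpperHalfPlane := ⟨τ, h⟩
  have hz : τ ≠ 0 := z.ne_zero
  have h1 := congrFun (EisensteinSeries.E2_slash_action ModularGroup.S) z
  rw [SlashInvariantForm.slash_S_apply, Pi.sub_apply, Pi.smul_apply, EisensteinSeries.D2_S,
    ← E2_eq_mathlib, ← E2_eq_mathlib, riemannZeta_two, zpow_neg, ← div_eq_mul_inv,
      div_eq_iff (zpow_ne_zero _ z.ne_zero)] at h1
  have h2 : -1 / τ = (-τ)⁻¹ := by rw [neg_div, one_div, inv_neg]
  rw [h2]
  refine h1.trans ?_
  have h3 : ((z : ℂ)) = τ := rfl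
  have h4 : (Real.pi : ℂ) ≠ 0 := by exact_mod_cast Real.pi_ne_zero
  have h5 : (z : ℂ) ^ (2 : ℤ) = τ ^ 2 := by rw [h3]; norm_cast
  rw [h5, h3, cc, smul_eq_mul]
  field_simp
  linear_combination (-6) * Complex.I_sq

lemma E4_S {τ : ℂ} (h : τ ∈ UHP) : E4 (-1 / τ) = τ ^ 4 * E4 τ := by
  let z : UpperHalfPlane := ⟨τ, h⟩
  have hz : τ ≠ 0 := z.ne_zero
  have h0 := (ModularForm.E (k := 4) (by norm_num)).slash_action_eq' _ ⟨ModularGroup.S, rfl⟩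
  have h1 := congrFun h0 z
  erw [SlashInvariantForm.slash_S_apply] at h1
  have h2 : -1 / τ = (-τ)⁻¹ := by rw [neg_div, one_div, inv_neg]
  rw [zpow_neg, ← div_eq_mul_inv, div_eq_iff (zpow_ne_zero _ z.ne_zero)] at h1
  have e1 := E4_eq_mathlib z
  have e2 := E4_eq_mathlib (.mk _ z.im_inv_neg_coe_pos)
  rw [h2]
  refine e2.trans (h1.trans ?_)
  rw [mul_comm]
  have h5 : (z : ℂ) ^ ((4 : ℕ) : ℤ) = τ ^ 4 := zpow_natCast _ _
  rw [h5]
  congr 1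
  exact e1.symm

lemma UHP_S {τ : ℂ} (h : τ ∈ UHP) : -1 / τ ∈ UHP := by
  have := UpperHalfPlane.im_inv_neg_coe_pos ⟨τ, h⟩
  have h2 : -1 / τ = (-τ)⁻¹ := by rw [neg_div, one_div, inv_neg]
  rw [h2]; exact this

lemma UHP_ne {τ : ℂ} (h : τ ∈ UHP) : τ ≠ 0 := by
  rintro rfl; simp [UHP] at h

lemma UHP_add {τ : ℂ} (h : τ ∈ UHP) (r : ℝ) : τ + r ∈ UHP := by
  simpa [UHP] using h

lemma UHP_add_one {τ : ℂ} (h : τ ∈ UHP) : τ + 1 ∈ UHP := by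
  simpa [UHP] using h

lemma UHP_three {τ : ℂ} (h : τ ∈ UHP) : 3 * τ ∈ UHP := by
  simpa [UHP] using h

lemma UHP_third {τ : ℂ} (h : τ ∈ UHP) : τ / 3 ∈ UHP := by
  have h' : 0 < τ.im := h
  have : (τ / 3).im = τ.im / 3 := by
    rw [show (3 : ℂ) = ((3 : ℝ) : ℂ) by norm_num, Complex.div_ofReal_im]
  show 0 < (τ / 3).im
  rw [this]; positivity

lemma UHP_thirdj {τ : ℂ} (h : τ ∈ UHP) (j : ℕ) : (τ + j) / 3 ∈ UHP :=
  UHP_third (by simpa [UHP] using h)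

lemma qc_tendsto : Filter.Tendsto (fun τ : UpperHalfPlane => qc τ) UpperHalfPlane.atImInfty (nhds 0) := by
  have := UpperHalfPlane.qParam_tendsto_atImInfty (h := 1) one_pos
  refine this.congr fun τ => ?_
  simp [Function.Periodic.qParam, qc]

lemma two_pi_I_ne : (2 * (Real.pi : ℂ) * I) ≠ 0 := Complex.two_pi_I_ne_zero

lemma qc_hasDeriv (τ : ℂ) : HasDerivAt qc (2 * (Real.pi : ℂ) * I * qc τ) τ := by
  have h := ((hasDerivAt_id τ).const_mul (2 * (Real.pi : ℂ) * I)).cexp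
  simp only [id, mul_one] at h
  rw [mul_comm]
  exact h

lemma DE2_eq {τ : ℂ} (h : τ ∈ UHP) : Dop E2 τ = qc τ * deriv pf (qc τ) := by
  have h1 : HasDerivAt pf (deriv pf (qc τ)) (qc τ) :=
    (pf_diff.differentiableAt (Metric.isOpen_ball.mem_nhds (qc_norm h))).hasDerivAt
  have h2 := h1.comp τ (qc_hasDeriv τ)
  have h3 : E2 = pf ∘ qc := funext E2_eq_pf
  rw [Dop, h3, h2.deriv]
  have := two_pi_I_ne
  field_simp

lemma Dop_diff {f : ℂ → ℂ} (h : DifferentiableOn ℂ f UHP) : DifferentiableOn ℂ (Dop f) UHP := by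
  have := h.deriv isOpen_UHP
  unfold Dop
  fun_prop

lemma E2_at {τ : ℂ} (h : τ ∈ UHP) : HasDerivAt E2 (2 * (Real.pi : ℂ) * I * Dop E2 τ) τ := by
  have := (E2_diff.differentiableAt (isOpen_UHP.mem_nhds h)).hasDerivAt
  refine this.congr_deriv ?_
  simp only [Dop]
  rw [mul_inv_cancel_left₀ two_pi_I_ne]

lemma DE2_S {τ : ℂ} (h : τ ∈ UHP) :
    12 * Dop E2 (-1 / τ) = 12 * τ ^ 4 * Dop E2 τ + 2 * cc * τ ^ 3 * E2 τ + cc ^ 2 * τ ^ 2 := by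
  have hτ := UHP_ne h
  have h1 : HasDerivAt (fun z : ℂ => -1 / z) (1 / τ ^ 2) τ := by
    have := (hasDerivAt_inv hτ).neg
    refine (this.congr_deriv (by simp)).congr_of_eventuallyEq (Filter.Eventually.of_forall ?_)
    intro z; simp [neg_div]
  have h2 := (E2_at (UHP_S h)).comp τ h1
  have h3 : HasDerivAt (fun z => z ^ 2 * E2 z + cc * z)
      (2 * τ * E2 τ + τ ^ 2 * (2 * (Real.pi : ℂ) * I * Dop E2 τ) + cc) τ := by
    have := (((hasDerivAt_pow 2 τ).mul (E2_at h)).add ((hasDerivAt_id τ).const_mul cc))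
    refine this.congr_deriv (by simp)
  have h4 : (E2 ∘ fun z : ℂ => -1 / z) =ᶠ[nhds τ] fun z => z ^ 2 * E2 z + cc * z := by
    filter_upwards [isOpen_UHP.mem_nhds h] with z hz
    exact E2_S hz
  have h5 := (h3.congr_of_eventuallyEq h4).unique h2
  have hc : cc * (2 * Real.pi * I) = 12 := by
    have := two_pi_I_ne
    have h4 : (Real.pi : ℂ) ≠ 0 := by exact_mod_cast Real.pi_ne_zero
    rw [cc]; field_simp; norm_num
  generalize Dop E2 (-1 / τ) = X at *
  generalize Dop E2 τ = Y at *
  generalize E2 τ = P at *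
  have h6 : 2 * Real.pi * I * X = τ ^ 2 * (2 * τ * P + τ ^ 2 * (2 * Real.pi * I * Y) + cc) := by
    rw [h5]; field_simp
  linear_combination cc * h6 + (τ ^ 4 * Y - X) * hc

lemma Dop_add_one {f : ℂ → ℂ} (h : ∀ τ, f (τ + 1) = f τ) (τ : ℂ) :
    Dop f (τ + 1) = Dop f τ := by
  have h2 : deriv (fun x => f (x + 1)) τ = deriv f (τ + 1) := deriv_comp_add_const f 1 τ
  rw [Dop, Dop, ← h2]
  congr 2
  exact funext h

lemma ramanujan : ∀ τ ∈ UHP, 12 * Dop E2 τ - E2 τ ^ 2 + E4 τ = 0 := by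
  refine levelOne_vanish (fun τ => 12 * Dop E2 τ - E2 τ ^ 2 + E4 τ) 4 1 (by norm_num) ?_ ?_ ?_ ?_
  · have h1 := E2_diff
    have h2 := E4_diff
    have h3 := Dop_diff E2_diff
    fun_prop
  · intro τ _
    simp only [E2_add_one, E4_add_one, Dop_add_one E2_add_one]
  · intro τ h
    simp only [DE2_S h, E2_S h, E4_S h]
    ring
  · have hp := pf_bigO
    have hb : (Metric.ball (0 : ℂ) 1) ∈ nhds (0 : ℂ) := Metric.ball_mem_nhds _ one_pos
    have h0 : (fun x : ℂ => 12 * (x * deriv pf x) - pf x ^ 2 + qf x) =O[nhds 0]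
        fun x : ℂ => x := by
      have a1 : DifferentiableAt ℂ (fun x : ℂ => 12 * (x * deriv pf x) - pf x ^ 2 + qf x) 0 := by
        have b1 := pf_diff.differentiableAt hb
        have b2 := qf_diff.differentiableAt hb
        have b3 := (pf_diff.deriv Metric.isOpen_ball).differentiableAt hb
        fun_prop
      have := a1.isBigO_sub
      refine this.congr (fun x => ?_) (fun x => ?_)
      · simp [pf, qf]
      · simp
    have h1 := h0.comp_tendsto qc_tendsto
    refine h1.congr (fun τ => ?_) (fun τ => ?_)
    · simp only [Function.comp, DE2_eq τ.2, E2_eq_pf, E4_eq_qf]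
    · simp

def Finf (τ : ℂ) : ℂ := 5 * (3 * E2 (3 * τ) - E2 τ) ^ 2 - 2 * (E4 τ + 9 * E4 (3 * τ))
def Fj (j : ℕ) (τ : ℂ) : ℂ :=
  5 * (E2 ((τ + j) / 3) / 3 - E2 τ) ^ 2 - 2 * (E4 τ + E4 ((τ + j) / 3) / 9)

lemma E2_sub_one (τ : ℂ) : E2 (τ - 1) = E2 τ := by
  have := E2_add_one (τ - 1); rw [sub_add_cancel] at this; exact this.symm
lemma E4_sub_one (τ : ℂ) : E4 (τ - 1) = E4 τ := by
  have := E4_add_one (τ - 1); rw [sub_add_cancel] at this; exact this.symm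

lemma Finf_T (τ : ℂ) : Finf (τ + 1) = Finf τ := by
  have e : 3 * (τ + 1) = 3 * τ + 1 + 1 + 1 := by ring
  simp only [Finf, e, E2_add_one, E4_add_one]

lemma Fj_T (j : ℕ) (τ : ℂ) : Fj j (τ + 1) = Fj (j + 1) τ := by
  have e : (τ + 1 + j) / 3 = (τ + (j + 1 : ℕ)) / 3 := by push_cast; ring
  simp only [Fj, e, E2_add_one, E4_add_one]

lemma F3 (τ : ℂ) : Fj 3 τ = Fj 0 τ := by
  have e : (τ + (3 : ℕ)) / 3 = (τ + (0 : ℕ)) / 3 + 1 := by push_cast; ring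
  simp only [Fj, e, E2_add_one, E4_add_one]

lemma Finf_S {τ : ℂ} (h : τ ∈ UHP) : Finf (-1 / τ) = τ ^ 4 * Fj 0 τ := by
  have hτ := UHP_ne h
  have e : 3 * (-1 / τ) = -1 / (τ / 3) := by field_simp
  have e2 : (τ + (0 : ℕ)) / 3 = τ / 3 := by simp
  simp only [Finf, Fj, e, e2, E2_S h, E4_S h, E2_S (UHP_third h), E4_S (UHP_third h)]
  ring

lemma F0_S {τ : ℂ} (h : τ ∈ UHP) : Fj 0 (-1 / τ) = τ ^ 4 * Finf τ := by
  have hτ := UHP_ne h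
  have e : (-1 / τ + (0 : ℕ)) / 3 = -1 / (3 * τ) := by field_simp; simp
  simp only [Finf, Fj, e, E2_S h, E4_S h, E2_S (UHP_three h), E4_S (UHP_three h)]
  ring

lemma F1_S {τ : ℂ} (h : τ ∈ UHP) : Fj 1 (-1 / τ) = τ ^ 4 * Fj 2 τ := by
  have hτ := UHP_ne h
  obtain ⟨w, hw⟩ : ∃ w, w = (τ + (2 : ℕ)) / 3 := ⟨_, rfl⟩
  have hwU : w ∈ UHP := hw ▸ UHP_thirdj h 2
  have hw1 : w - 1 ∈ UHP := by
    have := UHP_add hwU (-1)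
    simpa [sub_eq_add_neg] using this
  have hw0 := UHP_ne hw1
  have hτw : τ = 3 * w - 2 := by rw [hw]; push_cast; ring
  obtain ⟨u, hu⟩ : ∃ u, u = -1 / (w - 1) - 1 - 1 - 1 := ⟨_, rfl⟩
  have hu' : u = -τ / (w - 1) := by rw [hu, hτw]; field_simp; ring
  have huU : u ∈ UHP := by
    have := UHP_add (UHP_S hw1) (-3)
    rw [hu]
    convert this using 1
    push_cast; ring
  have hu0 := UHP_ne huU
  have hP : E2 u = (w - 1) ^ 2 * E2 w + cc * (w - 1) := by
    rw [hu, E2_sub_one, E2_sub_one, E2_sub_one, E2_S hw1, E2_sub_one]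
  have hQ : E4 u = (w - 1) ^ 4 * E4 w := by
    rw [hu, E4_sub_one, E4_sub_one, E4_sub_one, E4_S hw1, E4_sub_one]
  have hP2 : E2 (-1 / u) = τ ^ 2 * E2 w + 3 * cc * τ := by
    rw [E2_S huU, hP, hu', hτw]; field_simp; ring
  have hQ2 : E4 (-1 / u) = τ ^ 4 * E4 w := by
    rw [E4_S huU, hQ, hu']; field_simp
  have e : (-1 / τ + (1 : ℕ)) / 3 = -1 / u := by
    rw [hu', hw]; field_simp; push_cast; ring
  simp only [Fj, e, ← hw, hP2, hQ2, E2_S h, E4_S h]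
  ring

lemma F2_S {τ : ℂ} (h : τ ∈ UHP) : Fj 2 (-1 / τ) = τ ^ 4 * Fj 1 τ := by
  have hτ := UHP_ne h
  have := F1_S (UHP_S h)
  have e : -1 / (-1 / τ) = τ := by field_simp
  rw [e] at this
  rw [this]; field_simp

lemma Finf_diff : DifferentiableOn ℂ Finf UHP := by
  have h1 := E2_diff
  have h2 := E4_diff
  have h3 : DifferentiableOn ℂ (fun τ => E2 (3 * τ)) UHP :=
    E2_diff.comp (f := fun τ : ℂ => 3 * τ) (by fun_prop) fun τ h => UHP_three h
  have h4 : DifferentiableOn ℂ (fun τ => E4 (3 * τ)) UHP :=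
    E4_diff.comp (f := fun τ : ℂ => 3 * τ) (by fun_prop) fun τ h => UHP_three h
  unfold Finf; fun_prop

lemma Fj_diff (j : ℕ) : DifferentiableOn ℂ (Fj j) UHP := by
  have h1 := E2_diff
  have h2 := E4_diff
  have h3 : DifferentiableOn ℂ (fun τ : ℂ => E2 ((τ + j) / 3)) UHP :=
    E2_diff.comp (f := fun τ : ℂ => (τ + j) / 3) (by fun_prop) fun τ h => UHP_thirdj h j
  have h4 : DifferentiableOn ℂ (fun τ : ℂ => E4 ((τ + j) / 3)) UHP :=
    E4_diff.comp (f := fun τ : ℂ => (τ + j) / 3) (by fun_prop) fun τ h => UHP_thirdj h j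
  unfold Fj; fun_prop

lemma qc_three (τ : ℂ) : qc (3 * τ) = qc τ ^ 3 := by
  rw [qc, qc, ← Complex.exp_nat_mul]; congr 1; push_cast; ring

lemma Finf_bigO : (fun τ : UpperHalfPlane => Finf τ) =O[UpperHalfPlane.atImInfty]
    fun τ : UpperHalfPlane => qc τ ^ 2 := by
  have hb : (Metric.ball (0 : ℂ) 1) ∈ nhds (0 : ℂ) := Metric.ball_mem_nhds _ one_pos
  have cp : ContinuousAt pf 0 := (pf_diff.differentiableAt hb).continuousAt
  have cq : ContinuousAt qf 0 := (qf_diff.differentiableAt hb).continuousAt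
  have t3 : Filter.Tendsto (fun x : ℂ => x ^ 3) (nhds 0) (nhds 0) := by
    have : ContinuousAt (fun x : ℂ => x ^ 3) 0 := by fun_prop
    simpa [ContinuousAt] using this
  have o32 : (fun x : ℂ => x ^ 3) =O[nhds 0] fun x : ℂ => x ^ 2 := by
      have h1 : (fun x : ℂ => x) =O[nhds 0] fun _ : ℂ => (1 : ℂ) :=
        (continuousAt_id (x := (0 : ℂ))).tendsto.isBigO_one ℂ
      have := (Asymptotics.isBigO_refl (fun x : ℂ => x ^ 2) (nhds 0)).mul h1
      exact this.congr (fun x => by ring) (fun x => by ring)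
  have hdiff1 : ∀ f : ℂ → ℂ, DifferentiableAt ℂ f 0 → (fun x : ℂ => f (x ^ 3) - f 0) =O[nhds 0]
      fun x : ℂ => x ^ 2 := by
    intro f hf
    have h1 := hf.isBigO_sub.comp_tendsto t3
    refine Asymptotics.IsBigO.trans (h1.congr_right (fun x => ?_)) o32
    simp
  have hp3 := hdiff1 pf (pf_diff.differentiableAt hb)
  have hq3 := hdiff1 qf (qf_diff.differentiableAt hb)
  have hp0 : pf 0 = 1 := by simp [pf]
  have hq0 : qf 0 = 1 := by simp [qf]
  rw [hp0] at hp3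
  rw [hq0] at hq3
  have hA : (fun x : ℂ => (3 * pf (x ^ 3) - pf x) - (2 + 24 * x)) =O[nhds 0]
      fun x : ℂ => x ^ 2 := by
    exact ((hp3.const_mul_left 3).sub pf_bigO).congr_left fun x => by ring
  have hA2 : (fun x : ℂ => (3 * pf (x ^ 3) - pf x) + (2 + 24 * x)) =O[nhds 0]
      fun _ : ℂ => (1 : ℂ) := by
    have c3 : ContinuousAt (fun x : ℂ => pf (x ^ 3)) 0 :=
      ContinuousAt.comp (g := pf) (f := fun x : ℂ => x ^ 3) (by simpa using cp) (by fun_prop)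
    have : ContinuousAt (fun x : ℂ => (3 * pf (x ^ 3) - pf x) + (2 + 24 * x)) 0 := by fun_prop
    exact this.tendsto.isBigO_one ℂ
  have hA3 := hA.mul hA2
  have hx : (fun x : ℂ => x ^ 2) =O[nhds 0] fun x : ℂ => x ^ 2 := Asymptotics.isBigO_refl _ _
  have key : (fun x : ℂ => 5 * (3 * pf (x ^ 3) - pf x) ^ 2 - 2 * (qf x + 9 * qf (x ^ 3)))
      =O[nhds 0] fun x : ℂ => x ^ 2 := by
    have := (((hA3.congr_right fun x => mul_one _).const_mul_left 5).sub
      ((qf_bigO.add (hq3.const_mul_left 9)).const_mul_left 2)).add (hx.const_mul_left 2880)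
    exact this.congr_left fun x => by ring
  refine (key.comp_tendsto qc_tendsto).congr_left fun τ => ?_
  simp only [Function.comp, Finf, E2_eq_pf, E4_eq_qf, qc_three]

lemma qc_tendsto_third (j : ℕ) : Filter.Tendsto (fun τ : UpperHalfPlane => qc ((τ + j) / 3))
    UpperHalfPlane.atImInfty (nhds 0) := by
  have h1 := UpperHalfPlane.qParam_tendsto_atImInfty (h := 3) (by norm_num)
  have h2 := h1.const_mul (qc (j / 3))
  rw [mul_zero] at h2
  refine h2.congr fun τ => ?_
  rw [Function.Periodic.qParam, qc, qc, ← Complex.exp_add]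
  congr 1
  push_cast; ring

lemma Fj_bigO (j : ℕ) : (fun τ : UpperHalfPlane => Fj j τ) =O[UpperHalfPlane.atImInfty]
    fun _ : UpperHalfPlane => (1 : ℂ) := by
  have hb : (Metric.ball (0 : ℂ) 1) ∈ nhds (0 : ℂ) := Metric.ball_mem_nhds _ one_pos
  have cp : ContinuousAt pf 0 := (pf_diff.differentiableAt hb).continuousAt
  have cq : ContinuousAt qf 0 := (qf_diff.differentiableAt hb).continuousAt
  have p1 := cp.tendsto.comp qc_tendsto
  have p2 := cp.tendsto.comp (qc_tendsto_third j)
  have q1 := cq.tendsto.comp qc_tendsto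
  have q2 := cq.tendsto.comp (qc_tendsto_third j)
  have := ((((p2.div_const 3).sub p1).pow 2).const_mul 5).sub ((q1.add (q2.div_const 9)).const_mul 2)
  refine (this.isBigO_one ℂ).congr_left fun τ => ?_
  simp only [Function.comp, Fj, E2_eq_pf, E4_eq_qf]

lemma N_zero : ∀ τ ∈ UHP, Finf τ * Fj 0 τ * Fj 1 τ * Fj 2 τ = 0 := by
  refine levelOne_vanish (fun τ => Finf τ * Fj 0 τ * Fj 1 τ * Fj 2 τ) 16 2 (by norm_num) ?_ ?_ ?_ ?_
  · exact ((Finf_diff.mul (Fj_diff 0)).mul (Fj_diff 1)).mul (Fj_diff 2)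
  · intro τ _
    simp only [Finf_T, Fj_T, zero_add, Nat.reduceAdd, F3]
    ring
  · intro τ h
    simp only [Finf_S h, F0_S h, F1_S h, F2_S h]
    ring
  · refine (((Finf_bigO.mul (Fj_bigO 0)).mul (Fj_bigO 1)).mul (Fj_bigO 2)).congr_right ?_
    intro τ; ring

lemma UHP_preconn : IsPreconnected UHP := (convex_halfSpace_im_gt 0).isPreconnected

lemma Finf_of_F0 (h : ∀ τ ∈ UHP, Fj 0 τ = 0) : ∀ τ ∈ UHP, Finf τ = 0 := by
  intro τ hτ
  have := F0_S hτ
  rw [h _ (UHP_S hτ)] at this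
  exact (mul_eq_zero.mp this.symm).resolve_left (pow_ne_zero _ (UHP_ne hτ))

lemma Fj_pred (j : ℕ) (h : ∀ τ ∈ UHP, Fj (j + 1) τ = 0) : ∀ τ ∈ UHP, Fj j τ = 0 := by
  intro τ hτ
  have h1 := Fj_T j (τ - 1)
  have : τ - 1 ∈ UHP := by
    have := UHP_add hτ (-1)
    simpa [sub_eq_add_neg] using this
  rw [h _ this, sub_add_cancel] at h1
  exact h1

lemma Finf_zero : ∀ τ ∈ UHP, Finf τ = 0 := by
  have an : ∀ {f : ℂ → ℂ}, DifferentiableOn ℂ f UHP → AnalyticOnNhd ℂ f UHP :=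
    fun h => h.analyticOnNhd isOpen_UHP
  have d0 := Finf_diff.mul (Fj_diff 0)
  have d1 := d0.mul (Fj_diff 1)
  rcases AnalyticOnNhd.eq_zero_or_eq_zero_of_mul_eq_zero (an d1) (an (Fj_diff 2)) N_zero
    UHP_preconn with h | h
  · rcases AnalyticOnNhd.eq_zero_or_eq_zero_of_mul_eq_zero (an d0) (an (Fj_diff 1)) h
      UHP_preconn with h | h
    · rcases AnalyticOnNhd.eq_zero_or_eq_zero_of_mul_eq_zero (an Finf_diff) (an (Fj_diff 0)) h
        UHP_preconn with h | h
      · exact h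
      · exact Finf_of_F0 h
    · exact Finf_of_F0 (Fj_pred 0 h)
  · exact Finf_of_F0 (Fj_pred 0 (Fj_pred 1 h))

lemma eta_eq : dedekindEta = ModularForm.eta := by
  funext τ
  rw [dedekindEta, ModularForm.eta]
  congr 1
  refine tprod_congr fun n => ?_
  rw [ModularForm.eta_q_eq_pow, qc]

lemma eta_ne {τ : ℂ} (h : τ ∈ UHP) : dedekindEta τ ≠ 0 := by
  rw [eta_eq]; exact ModularForm.eta_ne_zero h

lemma eta_hasDeriv {τ : ℂ} (h : τ ∈ UHP) :
    HasDerivAt dedekindEta (Real.pi * I / 12 * E2 τ * dedekindEta τ) τ := by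
  have h1 := (ModularForm.differentiableAt_eta_of_mem_upperHalfPlaneSet h).hasDerivAt
  have h2 := ModularForm.logDeriv_eta_eq_E2 ⟨τ, h⟩
  rw [← E2_eq_mathlib, logDeriv_apply] at h2
  have h0 := eta_ne h
  rw [eta_eq] at h0 ⊢
  refine h1.congr_deriv ?_
  rw [div_eq_iff h0] at h2
  exact h2

lemma charA1_hasDeriv {τ : ℂ} (h : τ ∈ UHP) :
    HasDerivAt charA1 (2 * Real.pi * I * (charA1 τ * ((3 * E2 (3 * τ) - E2 τ) / 8))) τ := by
  have h1 := (eta_hasDeriv h).pow 3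
  have h2 := ((eta_hasDeriv (UHP_three h)).comp τ ((hasDerivAt_id τ).const_mul 3)).pow 3
  have h3 := h2.div h1 (pow_ne_zero _ (eta_ne h))
  refine h3.congr_deriv ?_
  have a := eta_ne h
  have b := eta_ne (UHP_three h)
  simp only [charA1, Function.comp, id, Pi.pow_apply]
  field_simp
  push_cast
  ring

lemma Dop_of_hasDeriv {f : ℂ → ℂ} {d τ : ℂ} (h : HasDerivAt f (2 * Real.pi * I * d) τ) :
    Dop f τ = d := by
  simp only [Dop]
  rw [h.deriv, inv_mul_cancel_left₀ two_pi_I_ne]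

theorem charA1_holo_and_MLDE :
    DifferentiableOn ℂ charA1 UHP ∧
      ∀ τ ∈ UHP,
        Dop (Dop charA1) τ - (1 / 6 : ℂ) * E2 τ * Dop charA1 τ
          - (1 / 48 : ℂ) * E4 τ * charA1 τ = 0 := by
  refine ⟨fun τ h => (charA1_hasDeriv h).differentiableAt.differentiableWithinAt, ?_⟩
  intro τ h
  have h1 : Dop charA1 =ᶠ[nhds τ] fun z => charA1 z * ((3 * E2 (3 * z) - E2 z) / 8) := by
    filter_upwards [isOpen_UHP.mem_nhds h] with z hz
    exact Dop_of_hasDeriv (charA1_hasDeriv hz)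
  have h3 : HasDerivAt (fun z => E2 (3 * z)) (2 * Real.pi * I * (3 * Dop E2 (3 * τ))) τ := by
    have := (E2_at (UHP_three h)).comp τ ((hasDerivAt_id τ).const_mul 3)
    exact this.congr_deriv (by ring)
  have h4 := (charA1_hasDeriv h).mul (((h3.const_mul 3).sub (E2_at h)).div_const 8)
  have h5 : Dop (Dop charA1) τ = charA1 τ * ((3 * E2 (3 * τ) - E2 τ) / 8) ^ 2
      + charA1 τ * ((9 * Dop E2 (3 * τ) - Dop E2 τ) / 8) := by
    refine Dop_of_hasDeriv ((h4.congr_of_eventuallyEq h1).congr_deriv ?_)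
    simp only [Pi.sub_apply]
    ring
  have h6 := Dop_of_hasDeriv (charA1_hasDeriv h)
  have r1 := ramanujan τ h
  have r2 := ramanujan (3 * τ) (UHP_three h)
  have r3 := Finf_zero τ h
  rw [Finf] at r3
  rw [h5, h6]
  linear_combination charA1 τ * (9 / 96 * r2 - 1 / 96 * r1 + r3 * (1 / 192))
end
end

section
/- Let f : ℍ → ℂ be defined by f(τ) = η(2τ)⁸/η(τ)⁸. Then f is holomorphic on ℍ and satisfies the second-order modular linear differential equation D²f − (1/6)·E₂·Df − (1/18)·E₄·f = 0 on ℍ (this is the MLDE of weight 0 with parameter h = 3, since (h−1)(h+1)/144 = 8/144 = 1/18). (In the paper, f is the normalized character of the simple affine vertex algebra V_{−3/2}(A₂).) -/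
noncomputable section

open Complex

/-- The normalized character of `V_{-3/2}(A₂)`: `f(τ) = η(2τ)⁸ / η(τ)⁸`. -/
def charA2 (τ : ℂ) : ℂ := dedekindEta (2 * τ) ^ 8 / dedekindEta τ ^ 8

namespace A2aux

open UpperHalfPlane hiding I
open Filter Topology ModularGroup
open scoped Manifold MatrixGroups ModularForm Derivative Real CongruenceSubgroup

/-- scaling of the upper half-plane -/
def scl (c : ℝ) (hc : 0 < c) (τ : ℍ) : ℍ := ⟨c * τ, by simpa using mul_pos hc τ.im_pos⟩

lemma coe_scl (c : ℝ) (hc : 0 < c) (τ : ℍ) : ((scl c hc τ : ℍ) : ℂ) = c * τ := rfl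

lemma mdiff_scl {F : ℍ → ℂ} (hF : MDiff F) (c : ℝ) (hc : 0 < c) :
    MDiff (fun τ => F (scl c hc τ)) := by
  rw [UpperHalfPlane.mdifferentiable_iff] at hF ⊢
  have h1 : DifferentiableOn ℂ (fun z : ℂ => (F ∘ ofComplex) (c * z)) upperHalfPlaneSet := by
    refine hF.comp (by fun_prop) ?_
    intro z hz
    have hz' : 0 < z.im := hz
    simpa [upperHalfPlaneSet] using mul_pos hc hz'
  refine h1.congr ?_
  intro z hz
  have hz' : 0 < z.im := hz
  have hz2 : 0 < ((c : ℂ) * z).im := by simpa using mul_pos hc hz'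
  simp only [Function.comp_apply, ofComplex_apply_of_im_pos hz', ofComplex_apply_of_im_pos hz2]
  rfl

lemma tendsto_scl (c : ℝ) (hc : 0 < c) : Tendsto (scl c hc) atImInfty atImInfty := by
  unfold atImInfty
  rw [tendsto_comap_iff]
  have : UpperHalfPlane.im ∘ scl c hc = fun τ => c * UpperHalfPlane.im τ := by
    funext τ
    have := congrArg Complex.im (coe_scl c hc τ)
    simpa using this
  rw [this]
  exact Tendsto.const_mul_atTop hc tendsto_comap

lemma coe_T_smul (τ : ℍ) : ((T • τ : ℍ) : ℂ) = τ + 1 := by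
  rw [modular_T_smul, coe_vadd, add_comm]
  simp

lemma coe_S_smul (τ : ℍ) : ((S • τ : ℍ) : ℂ) = (-(τ : ℂ))⁻¹ := by
  rw [modular_S_smul]

lemma tendsto_T : Tendsto (fun τ : ℍ => T • τ) atImInfty atImInfty := by
  unfold atImInfty
  rw [tendsto_comap_iff]
  have : UpperHalfPlane.im ∘ (fun τ : ℍ => T • τ) = UpperHalfPlane.im := by
    funext τ
    exact im_T_smul τ
  rw [this]
  exact tendsto_comap

lemma periodic_of_T {f : ℍ → ℂ} (h : ∀ τ, f (T • τ) = f τ) :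
    Function.Periodic (f ∘ ofComplex) ((1 : ℝ) : ℂ) := by
  intro w
  by_cases hw : 0 < w.im
  · have h2 : 0 < (w + ((1 : ℝ) : ℂ)).im := by simpa using hw
    simp only [Function.comp_apply, ofComplex_apply_of_im_pos h2, ofComplex_apply_of_im_pos hw]
    rw [← h ⟨w, hw⟩, modular_T_smul]
    congr 1
    ext
    simp [add_comm]
  · have h1 : w.im ≤ 0 := not_lt.mp hw
    have h2 : (w + ((1 : ℝ) : ℂ)).im ≤ 0 := by simpa using h1
    simp only [Function.comp_apply, ofComplex_apply_of_im_nonpos h2,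
      ofComplex_apply_of_im_nonpos h1]

lemma tendsto_of_hasSum {f : ℍ → ℂ} {c : ℕ → ℂ} (hper : ∀ τ, f (T • τ) = f τ) (hf : MDiff f)
    (hs : ∀ τ : ℍ, HasSum (fun m ↦ c m • Function.Periodic.qParam 1 τ ^ m) (f τ)) :
    Tendsto f atImInfty (𝓝 (c 0)) := by
  have hb := isBoundedAtImInfty_of_hasSum_qExpansion one_pos hs
  have ha := analyticAt_cuspFunction_zero one_pos (periodic_of_T hper) hf hb
  have hp := hasFPowerSeriesOnBall_cuspFunction one_pos ha hs
  have h0 : cuspFunction 1 f 0 = c 0 := by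
    have := hp.coeff_zero (fun _ => 0)
    rw [← this]
    simp [FormalMultilinearSeries.ofScalars]
  have : (cuspFunction 1 f ∘ fun τ : ℍ ↦ Function.Periodic.qParam 1 τ) = f := by
    funext τ
    simpa using eq_cuspFunction τ one_ne_zero (periodic_of_T hper)
  rw [← h0]
  have h2 := ha.continuousAt.tendsto.comp (qParam_tendsto_atImInfty one_pos)
  rwa [this] at h2

lemma slash_T_apply (f : ℍ → ℂ) (k : ℤ) (τ : ℍ) : (f ∣[k] T) τ = f (T • τ) := by
  rw [ModularForm.SL_slash_apply]
  rw [denom]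
  simp [coe_T]

lemma slash_S_apply' (f : ℍ → ℂ) (k : ℤ) (τ : ℍ) :
    (f ∣[k] S) τ = f (S • τ) * (τ : ℂ) ^ (-k) := by
  rw [SlashInvariantForm.slash_S_apply, modular_S_smul]

lemma EE_T (τ : ℍ) : EisensteinSeries.E2 (T • τ) = EisensteinSeries.E2 τ := by
  rw [← slash_T_apply EisensteinSeries.E2 2, EisensteinSeries.E2_slash_action, EisensteinSeries.D2_T]
  simp

lemma EE_S (τ : ℍ) : EisensteinSeries.E2 (S • τ) =
    (τ : ℂ) ^ 2 * EisensteinSeries.E2 τ - 6 * I / π * τ := by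
  have h := congrFun (EisensteinSeries.E2_slash_action S) τ
  rw [slash_S_apply'] at h
  simp only [Pi.sub_apply, Pi.smul_apply, smul_eq_mul, EisensteinSeries.D2_S,
    riemannZeta_two] at h
  have h0 : (τ : ℂ) ≠ 0 := τ.ne_zero
  have hpi : (π : ℂ) ≠ 0 := by exact_mod_cast Real.pi_ne_zero
  rw [show (-2 : ℤ) = -((2 : ℕ) : ℤ) from rfl, zpow_neg, zpow_natCast] at h
  have h3 : EisensteinSeries.E2 (S • τ) =
    (EisensteinSeries.E2 (S • τ) * ((τ : ℂ) ^ 2)⁻¹) * (τ : ℂ) ^ 2 := by field_simp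
  rw [h3, h]
  field_simp

lemma EE_tendsto : Tendsto EisensteinSeries.E2 atImInfty (𝓝 1) := by
  refine tendsto_of_hasSum (c := fun m => if m = 0 then 1 else -24 * ArithmeticFunction.sigma 1 m)
    EE_T _root_.E2_mdifferentiable ?_
  intro τ
  simpa only [Function.Periodic.qParam, ofReal_one, div_one] using
    EisensteinSeries.hasSum_qExpansion_E2 (z := τ)

lemma E4_slash (γ : SL(2, ℤ)) : (ModularForm.E₄ : ℍ → ℂ) ∣[(4 : ℤ)] γ = ModularForm.E₄ :=
  ModularForm.E₄.slash_action_eq' _ ⟨γ, rfl⟩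

lemma E4_tendsto : Tendsto ModularForm.E₄ atImInfty (𝓝 1) := by
  have hT : ∀ τ : ℍ, ModularForm.E₄ (T • τ) = ModularForm.E₄ τ := fun τ => by
    rw [← slash_T_apply ModularForm.E₄ 4, E4_slash]
  have := tendsto_of_hasSum hT ModularForm.E₄.holo' (fun τ =>
    ModularForm.hasSum_qExpansion (h := 1) ModularForm.E₄ one_pos one_mem_strictPeriods_SL τ)
  rwa [EisensteinSeries.E_qExpansion_coeff_zero _ ⟨2, rfl⟩] at this

/-- the three conjugates -/
def g1 (τ : ℍ) : ℂ := 2 * EisensteinSeries.E2 (scl 2 two_pos τ) - EisensteinSeries.E2 τ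

def g2 (τ : ℍ) : ℂ :=
  EisensteinSeries.E2 (scl (1 / 2) (by norm_num) τ) / 2 - EisensteinSeries.E2 τ

def g3 (τ : ℍ) : ℂ := g2 (T • τ)

lemma mdiff_g1 : MDiff g1 :=
  ((mdiff_scl _root_.E2_mdifferentiable 2 two_pos).const_smul (2 : ℂ)).sub
    _root_.E2_mdifferentiable

lemma g1_T : g1 ∣[(2 : ℤ)] T = g1 := by
  funext τ
  rw [slash_T_apply]
  have : scl 2 two_pos (T • τ) = T • T • scl 2 two_pos τ := by
    ext
    simp only [coe_T_smul, coe_scl]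
    push_cast
    ring
  simp only [g1, this, EE_T]

lemma g1_S : g1 ∣[(2 : ℤ)] S = g2 := by
  funext τ
  rw [slash_S_apply']
  have : scl 2 two_pos (S • τ) = S • scl (1/2) (by norm_num) τ := by
    ext
    simp only [coe_S_smul, coe_scl]
    push_cast
    field_simp
  simp only [g1, g2, this, EE_S, coe_scl]
  have h0 : (τ : ℂ) ≠ 0 := τ.ne_zero
  have hpi : (π : ℂ) ≠ 0 := by exact_mod_cast Real.pi_ne_zero
  rw [show (-2 : ℤ) = -((2 : ℕ) : ℤ) from rfl, zpow_neg, zpow_natCast]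
  push_cast
  field_simp
  ring

lemma g2_S : g2 ∣[(2 : ℤ)] S = g1 := by
  funext τ
  rw [slash_S_apply']
  have : scl (1/2) (by norm_num) (S • τ) = S • scl 2 two_pos τ := by
    ext
    simp only [coe_S_smul, coe_scl]
    push_cast
    field_simp
  simp only [g1, g2, this, EE_S, coe_scl]
  have h0 : (τ : ℂ) ≠ 0 := τ.ne_zero
  have hpi : (π : ℂ) ≠ 0 := by exact_mod_cast Real.pi_ne_zero
  rw [show (-2 : ℤ) = -((2 : ℕ) : ℤ) from rfl, zpow_neg, zpow_natCast]
  push_cast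
  field_simp
  ring

lemma g2_T : g2 ∣[(2 : ℤ)] T = g3 := by
  funext τ
  rw [slash_T_apply]
  rfl

lemma g3_T : g3 ∣[(2 : ℤ)] T = g2 := by
  funext τ
  rw [slash_T_apply]
  have : scl (1/2) (by norm_num) (T • T • τ) = T • scl (1/2) (by norm_num) τ := by
    ext
    simp only [coe_T_smul, coe_scl]
    push_cast
    ring
  simp only [g3, g2, this, EE_T]

lemma g3_S : g3 ∣[(2 : ℤ)] S = g3 := by
  have e : S * T * S = T⁻¹ * S * T⁻¹ := by
    decide
  have h1 : g1 ∣[(2 : ℤ)] T⁻¹ = g1 := by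
    conv_lhs => rw [← g1_T]
    rw [← SlashAction.slash_mul]
    simp
  have h2 : g2 ∣[(2 : ℤ)] T⁻¹ = g3 := by
    rw [← g3_T, ← SlashAction.slash_mul]
    simp
  have h3 : g3 = g1 ∣[(2 : ℤ)] (S * T) := by
    rw [SlashAction.slash_mul, g1_S, g2_T]
  conv_lhs => rw [h3]
  rw [← SlashAction.slash_mul, e, SlashAction.slash_mul, SlashAction.slash_mul, h1, g1_S, h2]


lemma mdiff_g2 : MDiff g2 := by
  have := ((mdiff_scl _root_.E2_mdifferentiable (1 / 2) (by norm_num)).const_smul (1 / 2 : ℂ)).sub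
    _root_.E2_mdifferentiable
  convert! this using 1
  funext τ
  simp [g2]
  ring

lemma mdiff_g3 : MDiff g3 := by
  rw [← g2_T]
  exact MDifferentiable.slash mdiff_g2 2 _

/-- the obstruction to the differential equation -/
def Hf (g : ℍ → ℂ) : ℍ → ℂ :=
  (2 : ℂ) • (g * g) + (6 : ℂ) • Derivative.serreDerivative 2 g - ModularForm.E₄

lemma mdiff_Hf {g : ℍ → ℂ} (hg : MDiff g) : MDiff (Hf g) :=
  (((hg.mul hg).const_smul (2 : ℂ)).add
    ((Derivative.serreDerivative_mdifferentiable 2 hg).const_smul (6 : ℂ))).sub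
    ModularForm.E₄.holo'

lemma Hf_slash {g : ℍ → ℂ} (hg : MDiff g) (γ : SL(2, ℤ)) :
    Hf g ∣[(4 : ℤ)] γ = Hf (g ∣[(2 : ℤ)] γ) := by
  have h1 := ModularForm.mul_slash_SL2 2 2 γ g g
  have h2 := Derivative.serreDerivative_slash_equivariant (k := 2) hg (γ := γ)
  rw [show (2 : ℤ) + 2 = 4 by norm_num] at h1 h2
  rw [show ((2 : ℤ) : ℂ) = 2 by norm_num] at h2
  rw [Hf, Hf, ← h1, ← h2, sub_eq_add_neg, SlashAction.add_slash, SlashAction.add_slash,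
    SlashAction.neg_slash, E4_slash, ModularForm.SL_smul_slash, ModularForm.SL_smul_slash,
    sub_eq_add_neg]

lemma tendsto_D {F : ℍ → ℂ} (hF : MDiff F) {c : ℂ} (h : Tendsto F atImInfty (𝓝 c)) :
    Tendsto (Derivative.normalizedDerivOfComplex F) atImInfty (𝓝 0) := by
  rw [UpperHalfPlane.mdifferentiable_iff] at hF
  suffices h2 : Tendsto (fun z : ℍ => deriv (F ∘ ofComplex) z) atImInfty (𝓝 0) by
    have := h2.const_mul ((2 * π * I)⁻¹ : ℂ)
    rw [mul_zero] at this
    exact this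
  rw [Metric.tendsto_nhds] at h ⊢
  intro ε hε
  obtain ⟨A, hA⟩ := (atImInfty_mem _).1 (h (ε / 2) (half_pos hε))
  refine (atImInfty_mem _).2 ⟨max A 1 + 1, fun z hz => ?_⟩
  have hball : ∀ w ∈ Metric.closedBall (z : ℂ) 1, max A 1 ≤ w.im := by
    intro w hw
    have h1 : |(w - z).im| ≤ 1 :=
      (Complex.abs_im_le_norm _).trans (by simpa [dist_eq_norm] using hw)
    have h2 := (abs_le.1 h1).1
    rw [Complex.sub_im] at h2
    have h3 : (z : ℂ).im = z.im := rfl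
    linarith
  have hpos : ∀ w ∈ Metric.closedBall (z : ℂ) 1, 0 < w.im := fun w hw =>
    lt_of_lt_of_le one_pos ((le_max_right _ _).trans (hball w hw))
  have hd : DiffContOnCl ℂ (fun w => (F ∘ ofComplex) w - c) (Metric.ball (z : ℂ) 1) := by
    apply DifferentiableOn.diffContOnCl
    refine (hF.sub_const c).mono ?_
    exact (Metric.closure_ball_subset_closedBall).trans hpos
  have key := Complex.norm_deriv_le_of_forall_mem_sphere_norm_le one_pos hd (C := ε / 2) ?_
  · rw [deriv_sub_const] at key
    simp only [Set.mem_ofPred_eq, dist_zero_right]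
    linarith
  · intro w hw
    have hw' := Metric.sphere_subset_closedBall hw
    have := hA ⟨w, hpos w hw'⟩ ((le_max_left _ _).trans (hball w hw'))
    simp only [Function.comp_apply, ofComplex_apply_of_im_pos (hpos w hw')]
    rw [← dist_eq_norm]
    exact le_of_lt this

lemma tendsto_Hf {g : ℍ → ℂ} (hg : MDiff g) {c : ℂ} (h : Tendsto g atImInfty (𝓝 c)) :
    Tendsto (Hf g) atImInfty (𝓝 (2 * (c * c) + 6 * (0 - 2 * 12⁻¹ * 1 * c) - 1)) :=
  (((h.mul h).const_mul 2).add (((tendsto_D hg h).sub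
    (((EE_tendsto).const_mul (2 * 12⁻¹ : ℂ)).mul h)).const_mul 6)).sub E4_tendsto

lemma tendsto_g1 : Tendsto g1 atImInfty (𝓝 1) := by
  have := ((EE_tendsto.comp (tendsto_scl 2 two_pos)).const_mul 2).sub EE_tendsto
  norm_num at this
  exact this

lemma tendsto_g2 : Tendsto g2 atImInfty (𝓝 (-1 / 2)) := by
  have := ((EE_tendsto.comp (tendsto_scl (1 / 2) (by norm_num))).div_const 2).sub EE_tendsto
  norm_num at this ⊢
  exact this

lemma tendsto_H1 : Tendsto (Hf g1) atImInfty (𝓝 0) := by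
  have := tendsto_Hf mdiff_g1 tendsto_g1
  norm_num at this
  exact this

lemma tendsto_H2 : Tendsto (Hf g2) atImInfty (𝓝 0) := by
  have := tendsto_Hf mdiff_g2 tendsto_g2
  norm_num at this
  exact this

lemma tendsto_H3 : Tendsto (Hf g3) atImInfty (𝓝 0) := by
  have h : Hf g3 = (Hf g2) ∘ (fun τ => T • τ) := by
    funext τ
    rw [← g2_T, ← Hf_slash mdiff_g2, slash_T_apply]
    rfl
  rw [h]
  exact tendsto_H2.comp tendsto_T

/-- the norm -/
def Nf : ℍ → ℂ := Hf g1 * (Hf g2 * Hf g3)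

lemma Nf_slash (γ : SL(2, ℤ)) : Nf ∣[(12 : ℤ)] γ =
    Hf (g1 ∣[(2 : ℤ)] γ) * (Hf (g2 ∣[(2 : ℤ)] γ) * Hf (g3 ∣[(2 : ℤ)] γ)) := by
  rw [Nf, show (12 : ℤ) = 4 + (4 + 4) by norm_num, ModularForm.mul_slash_SL2,
    ModularForm.mul_slash_SL2, Hf_slash mdiff_g1, Hf_slash mdiff_g2, Hf_slash mdiff_g3]

lemma Nf_S : Nf ∣[(12 : ℤ)] S = Nf := by
  rw [Nf_slash, g1_S, g2_S, g3_S, Nf]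
  ring

lemma Nf_T : Nf ∣[(12 : ℤ)] T = Nf := by
  rw [Nf_slash, g1_T, g2_T, g3_T, Nf]
  ring

lemma tendsto_H23 : Tendsto (Hf g2 * Hf g3) atImInfty (𝓝 0) := by
  have := tendsto_H2.mul tendsto_H3
  rw [mul_zero] at this
  exact this

lemma tendsto_Nf : Tendsto Nf atImInfty (𝓝 0) := by
  have := tendsto_H1.mul tendsto_H23
  rw [mul_zero] at this
  exact this

/-- the norm as a cusp form -/
def Ncusp : CuspForm 𝒮ℒ 12 where
  toFun := Nf
  slash_action_eq' A hA := by
    obtain ⟨A, rfl⟩ := hA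
    exact SlashInvariantForm.slash_action_generators_SL2Z Nf_S Nf_T A
  holo' := (mdiff_Hf mdiff_g1).mul ((mdiff_Hf mdiff_g2).mul (mdiff_Hf mdiff_g3))
  zero_at_cusps' hc := by
    rw [Subgroup.IsArithmetic.isCusp_iff_isCusp_SL2Z] at hc
    rw [OnePoint.isZeroAt_iff_forall_SL2Z hc]
    intro γ _
    rw [SlashInvariantForm.slash_action_generators_SL2Z Nf_S Nf_T]
    exact tendsto_Nf

lemma H1_bigO : Hf g1 =O[atImInfty] ModularForm.discriminant := by
  have hT : ∀ τ, Hf g1 (T • τ) = Hf g1 τ := fun τ => by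
    rw [← slash_T_apply (Hf g1) 4, Hf_slash mdiff_g1, g1_T]
  have hz : IsZeroAtImInfty (Hf g1) := tendsto_H1
  have := hz.exp_decay_atImInfty one_pos (periodic_of_T hT) (mdiff_Hf mdiff_g1)
    (Filter.ZeroAtFilter.boundedAtFilter hz)
  simp only [div_one] at this
  exact this.trans ModularForm.exp_isBigO_discriminant

lemma Nf_zero : Nf = 0 := by
  obtain ⟨c, hc⟩ := CuspForm.exists_smul_discriminant_of_weight_eq_twelve Ncusp
  have hc' : ∀ τ, c * ModularForm.discriminant τ = Nf τ := fun τ => DFunLike.congr_fun hc τ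
  have ho : Nf =o[atImInfty] ModularForm.discriminant := by
    have h1 : (Hf g2 * Hf g3) =o[atImInfty] (fun _ => (1 : ℂ)) :=
      (Asymptotics.isLittleO_one_iff ℂ).2 tendsto_H23
    have := H1_bigO.mul_isLittleO h1
    simp only [mul_one] at this
    exact this
  have h0 : c = 0 := by
    have h1 : Tendsto (fun τ => Nf τ / ModularForm.discriminant τ) atImInfty (𝓝 0) :=
      ho.tendsto_div_nhds_zero
    have h2 : (fun τ => Nf τ / ModularForm.discriminant τ) = fun _ => c := by
      funext τ
      rw [← hc', mul_div_cancel_right₀ _ (ModularForm.discriminant_ne_zero τ)]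
    rw [h2] at h1
    exact tendsto_nhds_unique tendsto_const_nhds h1
  funext τ
  rw [← hc', h0]
  simp

lemma H1_zero : Hf g1 = 0 := by
  have hm1 := mdiff_Hf mdiff_g1
  have hm2 := mdiff_Hf mdiff_g2
  have hm3 := mdiff_Hf mdiff_g3
  have h21 : Hf g2 = 0 → Hf g1 = 0 := fun h => by
    rw [← g2_S, ← Hf_slash mdiff_g2, h, SlashAction.zero_slash]
  have h := Nf_zero
  rw [Nf, UpperHalfPlane.mul_eq_zero_iff hm1 (hm2.mul hm3),
    UpperHalfPlane.mul_eq_zero_iff hm2 hm3] at h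
  rcases h with h | h | h
  · exact h
  · exact h21 h
  · apply h21
    rw [← g3_T, ← Hf_slash mdiff_g3, h, SlashAction.zero_slash]

lemma sigmaC_eq (k n : ℕ) : sigmaC k n = ArithmeticFunction.sigma k n := by
  rw [sigmaC, ArithmeticFunction.sigma_apply]
  push_cast
  rfl

lemma E2_eq (τ : ℍ) : _root_.E2 (τ : ℂ) = EisensteinSeries.E2 τ := by
  rw [EisensteinSeries.E2_eq_tsum_cexp, tsum_pnat_eq_tsum_succ
    (f := fun n ↦ (ArithmeticFunction.sigma 1 n : ℂ) * cexp (2 * π * I * τ) ^ n)]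
  simp only [_root_.E2, sigmaC_eq, qc]

lemma E4_eq (τ : ℍ) : _root_.E4 (τ : ℂ) = ModularForm.E₄ τ := by
  have h := EisensteinSeries.q_expansion_bernoulli (by norm_num : 3 ≤ 4) ⟨2, rfl⟩ τ
  simp_rw [zpow_natCast] at h
  rw [tsum_pnat_eq_tsum_succ
    (f := fun n ↦ (ArithmeticFunction.sigma (4 - 1) n : ℂ) * cexp (2 * π * I * τ) ^ n)] at h
  rw [show bernoulli 4 = -1 / 30 by decide +kernel] at h
  rw [h]
  simp only [_root_.E4, sigmaC_eq, qc]
  push_cast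
  norm_num

lemma eta_eq : dedekindEta = ModularForm.eta := by
  funext z
  simp only [dedekindEta, ModularForm.eta, qc, ModularForm.eta_q_eq_pow, Function.Periodic.qParam]
  norm_num

lemma hasDerivAt_eta (z : ℍ) : HasDerivAt dedekindEta
    (dedekindEta z * (π * I / 12 * EisensteinSeries.E2 z)) (z : ℂ) := by
  rw [eta_eq]
  have h := ModularForm.logDeriv_eta_eq_E2 z
  rw [logDeriv_apply, div_eq_iff (ModularForm.eta_ne_zero z.2), mul_comm] at h
  rw [← h]
  exact (ModularForm.differentiableAt_eta_of_mem_upperHalfPlaneSet z.2).hasDerivAt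

lemma hasDerivAt_char (z : ℍ) : HasDerivAt charA2
    (charA2 z * (2 * π * I / 3 * g1 z)) (z : ℂ) := by
  have h1 := hasDerivAt_eta z
  have h0 := hasDerivAt_eta (scl 2 two_pos z)
  rw [show ((scl 2 two_pos z : ℍ) : ℂ) = 2 * (z : ℂ) by simp [coe_scl]] at h0
  have h2 : HasDerivAt (fun w : ℂ => dedekindEta (2 * w)) (dedekindEta (2 * (z : ℂ)) *
      (π * I / 12 * EisensteinSeries.E2 (scl 2 two_pos z)) * (2 * 1)) (z : ℂ) :=
    HasDerivAt.comp (h₂ := dedekindEta) (h := fun w : ℂ => 2 * w) (z : ℂ) h0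
      ((hasDerivAt_id (z : ℂ)).const_mul 2)
  have hne : dedekindEta z ≠ 0 := by
    rw [eta_eq]
    exact ModularForm.eta_ne_zero z.2
  have h3 := (h2.pow 8).div (h1.pow 8) (pow_ne_zero 8 hne)
  refine HasDerivAt.congr_deriv h3 ?_
  simp only [charA2, g1, Pi.pow_apply]
  field_simp
  push_cast
  ring

lemma Dop_char {w : ℂ} (hw : 0 < w.im) :
    Dop charA2 w = charA2 w * (g1 ∘ ofComplex) w / 3 := by
  have := (hasDerivAt_char ⟨w, hw⟩).deriv
  simp only [Function.comp_apply, ofComplex_apply_of_im_pos hw]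
  simp only [Dop]
  have hpi : (π : ℂ) ≠ 0 := by exact_mod_cast Real.pi_ne_zero
  erw [this]
  have : I ≠ 0 := I_ne_zero
  field_simp

lemma isOpen_UHP : IsOpen UHP := isOpen_lt continuous_const Complex.continuous_im

lemma Dop_Dop_char (z : ℍ) : Dop (Dop charA2) z =
    charA2 z * g1 z * g1 z / 9 + charA2 z * Derivative.normalizedDerivOfComplex g1 z / 3 := by
  have he : Dop charA2 =ᶠ[𝓝 (z : ℂ)] fun w => charA2 w * (g1 ∘ ofComplex) w / 3 := by
    filter_upwards [isOpen_UHP.mem_nhds (show (z : ℂ) ∈ UHP from z.2)] with w hw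
    exact Dop_char hw
  have hg : HasDerivAt (g1 ∘ ofComplex) (deriv (g1 ∘ ofComplex) z) (z : ℂ) := by
    have := UpperHalfPlane.mdifferentiable_iff.1 mdiff_g1
    exact (this.differentiableAt (isOpen_upperHalfPlaneSet.mem_nhds z.2)).hasDerivAt
  have h := (((hasDerivAt_char z).mul hg).div_const 3).deriv
  have hd : deriv (Dop charA2) z = _ := he.deriv_eq.trans h
  rw [Dop, hd, Derivative.normalizedDerivOfComplex]
  have hpi : (π : ℂ) ≠ 0 := by exact_mod_cast Real.pi_ne_zero
  have : I ≠ 0 := I_ne_zero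
  simp only [Function.comp_apply, ofComplex_apply]
  field_simp
  ring

lemma MLDE (z : ℍ) : Dop (Dop charA2) z - (1 / 6 : ℂ) * _root_.E2 z * Dop charA2 z
    - (1 / 18 : ℂ) * _root_.E4 z * charA2 z = 0 := by
  have h := congrFun H1_zero z
  simp only [Hf, Pi.sub_apply, Pi.add_apply, Pi.smul_apply, Pi.mul_apply, Pi.zero_apply,
    smul_eq_mul, Derivative.serreDerivative_apply] at h
  rw [Dop_Dop_char, Dop_char z.2, E2_eq, E4_eq]
  simp only [Function.comp_apply, ofComplex_apply]
  linear_combination charA2 z / 18 * h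

end A2aux

theorem charA2_holo_and_MLDE :
    DifferentiableOn ℂ charA2 UHP ∧
      ∀ τ ∈ UHP,
        Dop (Dop charA2) τ - (1 / 6 : ℂ) * E2 τ * Dop charA2 τ
          - (1 / 18 : ℂ) * E4 τ * charA2 τ = 0 := by
  refine ⟨fun z hz => ?_, fun τ hτ => A2aux.MLDE ⟨τ, hτ⟩⟩
  exact (A2aux.hasDerivAt_char ⟨z, hz⟩).differentiableAt.differentiableWithinAt
end
end
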